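/- arXiv:2507.03672 — 7 statements merged into one kernel-verified Lean document; each statement's English description precedes it below -/
import Mathlib

section
/- Let T be a bounded linear operator on a complex Hilbert space H, let k, n be natural numbers and λ > 0, and suppose T^{*k}(λ² T^*T − T^n T^{*n})T^k ≥ 0. Then for every natural number m with m ≥ k and every x ∈ H, ‖T^{*n}T^m x‖ ≤ λ‖T^{m+1}x‖. -/
open ContinuousLinearMap
open scoped ComplexInnerProductSpace ComplexOrder

/-- If `T^{*k}(λ² T^*T − Tⁿ T^{*n})T^k ≥ 0`, then for every `m ≥ k` and every
`x ∈ H`, `‖T^{*n} T^m x‖ ≤ λ ‖T^{m+1} x‖`. -/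
theorem stmt_1 {H : Type*} [NormedAddCommGroup H] [InnerProductSpace ℂ H] [CompleteSpace H]
    (T : H →L[ℂ] H) (k n : ℕ) (l : ℝ) (hl : 0 < l)
    (hT : ∀ x : H,
      (0 : ℂ) ≤
        ⟪((adjoint T) ^ k * (((l : ℂ) ^ 2) • (adjoint T * T) - T ^ n * (adjoint T) ^ n) * T ^ k)
            x, x⟫) :
    ∀ m : ℕ, k ≤ m → ∀ x : H, ‖((adjoint T) ^ n * T ^ m) x‖ ≤ l * ‖(T ^ (m + 1)) x‖ := by
  intro m hm x
  have hp : ∀ j : ℕ, (adjoint T) ^ j = adjoint (T ^ j) := by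
    intro j
    rw [← star_eq_adjoint, ← star_eq_adjoint, star_pow]
  obtain ⟨d, rfl⟩ := Nat.exists_eq_add_of_le hm
  have h := hT ((T ^ d) x)
  have e1 : (T ^ (k + d)) x = (T ^ k) ((T ^ d) x) := by rw [pow_add]; rfl
  have e2 : (T ^ (k + d + 1)) x = T ((T ^ k) ((T ^ d) x)) := by
    rw [pow_succ', ← e1]; rfl
  have e3 : ((adjoint T) ^ n * T ^ (k + d)) x = adjoint (T ^ n) ((T ^ k) ((T ^ d) x)) := by
    rw [← e1, hp]; rfl
  rw [e2, e3]
  generalize (T ^ d) x = y at *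
  rw [hp, hp] at h
  change 0 ≤ ⟪adjoint (T ^ k) (((l : ℂ) ^ 2) • adjoint T (T ((T ^ k) y)) - (T ^ n) (adjoint (T ^ n) ((T ^ k) y))), y⟫ at h
  rw [adjoint_inner_left] at h
  generalize (T ^ k) y = z at *
  rw [inner_sub_left, inner_smul_left, adjoint_inner_left, ← adjoint_inner_right (T ^ n),
    inner_self_eq_norm_sq_to_K, inner_self_eq_norm_sq_to_K] at h
  have h2 : 0 ≤ l ^ 2 * ‖T z‖ ^ 2 - ‖adjoint (T ^ n) z‖ ^ 2 := by
    have h3 : (0 : ℂ) ≤ ((l ^ 2 * ‖T z‖ ^ 2 - ‖adjoint (T ^ n) z‖ ^ 2 : ℝ) : ℂ) := by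
      simpa using h
    exact_mod_cast h3
  refine abs_le_of_sq_le_sq' (by nlinarith) (by positivity) |>.2
end

section
/- Let T be a bounded linear operator on a complex Hilbert space H and let k, n be natural numbers with k ≥ n ≥ 1. If T is k-quasi n-power posinormal and T^{k+1} = 0, then T^k = 0. -/
open ContinuousLinearMap
open scoped ComplexInnerProductSpace ComplexOrder

lemma adj_pow_aux {H : Type*} [NormedAddCommGroup H] [InnerProductSpace ℂ H] [CompleteSpace H]
    (T : H →L[ℂ] H) (m : ℕ) : (adjoint T) ^ m = adjoint (T ^ m) := by
  rw [← star_eq_adjoint, ← star_eq_adjoint, star_pow]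

/-- If `k ≥ n ≥ 1`, `T` is `k`-quasi `n`-power posinormal and `T^{k+1} = 0`,
then `T^k = 0`. -/
theorem stmt_2 {H : Type*} [NormedAddCommGroup H] [InnerProductSpace ℂ H] [CompleteSpace H]
    (T : H →L[ℂ] H) (k n : ℕ) (hn : 1 ≤ n) (hkn : n ≤ k)
    (hT : ∃ l : ℝ, 0 < l ∧ ∀ x : H,
      (0 : ℂ) ≤
        ⟪((adjoint T) ^ k * (((l : ℂ) ^ 2) • (adjoint T * T) - T ^ n * (adjoint T) ^ n) * T ^ k)
            x, x⟫)
    (hnil : T ^ (k + 1) = 0) :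
    T ^ k = 0 := by
  obtain ⟨l, hl, h⟩ := hT
  ext x
  have hx := h x
  have e1 : (adjoint T) ^ k * (((l : ℂ) ^ 2) • (adjoint T * T) - T ^ n * (adjoint T) ^ n) * T ^ k
      = - (adjoint (T ^ k) * (T ^ n * (adjoint (T ^ n) * T ^ k))) := by
    have : adjoint T * T * T ^ k = 0 := by
      rw [mul_assoc, ← pow_succ', hnil, mul_zero]
    rw [mul_assoc, sub_mul, smul_mul_assoc, this, smul_zero, zero_sub, mul_neg,
      adj_pow_aux, adj_pow_aux, mul_assoc]
  rw [e1] at hx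
  have e2 : adjoint (T ^ n) ((T ^ k) x) = 0 := by
    simp only [neg_apply, mul_apply_eq_comp, inner_neg_left, adjoint_inner_left] at hx
    rw [← adjoint_inner_right, inner_self_eq_norm_sq_to_K] at hx
    have h3 := (Complex.le_def.1 hx).1
    change (0:ℝ) ≤ (-(((‖adjoint (T ^ n) ((T ^ k) x)‖ : ℝ) : ℂ) ^ 2)).re at h3
    rw [← Complex.ofReal_pow] at h3
    simp only [Complex.neg_re, Complex.ofReal_re] at h3
    have h4 : ‖adjoint (T ^ n) ((T ^ k) x)‖ ^ 2 = 0 := le_antisymm (by linarith) (sq_nonneg _)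
    exact norm_eq_zero.1 (pow_eq_zero_iff (two_ne_zero) |>.1 h4)
  have e3 : (T ^ k) x = (T ^ n) ((T ^ (k - n)) x) := by
    rw [← mul_apply_eq_comp, ← pow_add, Nat.add_sub_cancel' hkn]
  have e4 : ⟪(T ^ k) x, (T ^ k) x⟫ = 0 := by
    nth_rewrite 2 [e3]
    rw [← adjoint_inner_left, e2, inner_zero_left]
  simpa using e4
end

section
/- Let T be a bounded linear operator on a complex Hilbert space H, let k, n be natural numbers and λ > 0, and suppose T^{*k}(λ² T^*T − T^n T^{*n})T^k ≥ 0. Then for every natural number m with m ≥ k, the operator norms satisfy ‖T^{*n}T^m‖ ≤ λ‖T^{m+1}‖. -/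
open ContinuousLinearMap
open scoped ComplexInnerProductSpace ComplexOrder

/-- If `T^{*k}(λ² T^*T − Tⁿ T^{*n})T^k ≥ 0`, then for every `m ≥ k` the operator
norms satisfy `‖T^{*n} T^m‖ ≤ λ ‖T^{m+1}‖`. -/
theorem stmt_3 {H : Type*} [NormedAddCommGroup H] [InnerProductSpace ℂ H] [CompleteSpace H]
    (T : H →L[ℂ] H) (k n : ℕ) (l : ℝ) (hl : 0 < l)
    (hT : ∀ x : H,
      (0 : ℂ) ≤
        ⟪((adjoint T) ^ k * (((l : ℂ) ^ 2) • (adjoint T * T) - T ^ n * (adjoint T) ^ n) * T ^ k)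
            x, x⟫) :
    ∀ m : ℕ, k ≤ m → ‖(adjoint T) ^ n * T ^ m‖ ≤ l * ‖T ^ (m + 1)‖ := by
  have hmul : ∀ (A B : H →L[ℂ] H) (x : H), (A * B) x = A (B x) := fun _ _ _ => rfl
  have hsub : ∀ (A B : H →L[ℂ] H) (x : H), (A - B) x = A x - B x := fun _ _ _ => rfl
  have hsm : ∀ (c : ℂ) (B : H →L[ℂ] H) (x : H), (c • B) x = c • B x := fun _ _ _ => rfl
  have hp : ∀ j : ℕ, (adjoint T) ^ j = adjoint (T ^ j) := by
    intro j
    rw [← star_eq_adjoint, ← star_eq_adjoint, star_pow]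
  have key : ∀ x : H, ‖((adjoint T) ^ n) ((T ^ k) x)‖ ≤ l * ‖T ((T ^ k) x)‖ := by
    intro x
    have h := hT x
    rw [hp k, hmul, hmul, adjoint_inner_left] at h
    generalize (T ^ k) x = y at h ⊢
    have e2 : ⟪(T ^ n) (((adjoint T) ^ n) y), y⟫ = ((‖((adjoint T) ^ n) y‖ ^ 2 : ℝ) : ℂ) := by
      rw [hp n, ← adjoint_inner_right, inner_self_eq_norm_sq_to_K]
      push_cast
      rfl
    have e1 : ⟪(adjoint T) (T y), y⟫ = ((‖T y‖ ^ 2 : ℝ) : ℂ) := by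
      rw [adjoint_inner_left, inner_self_eq_norm_sq_to_K]
      push_cast
      rfl
    rw [hsub, hsm, hmul, hmul, inner_sub_left, inner_smul_left, e1, e2] at h
    rw [map_pow, Complex.conj_ofReal] at h
    have h' : (0 : ℝ) ≤ l ^ 2 * ‖T y‖ ^ 2 - ‖((adjoint T) ^ n) y‖ ^ 2 := by
      exact_mod_cast h
    exact abs_le_of_sq_le_sq' (by nlinarith) (by positivity) |>.2
  intro m hm
  obtain ⟨d, rfl⟩ := Nat.exists_eq_add_of_le hm
  refine opNorm_le_bound _ (by positivity) fun x => ?_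
  have h := key ((T ^ d) x)
  have a1 : (T ^ k) ((T ^ d) x) = (T ^ (k + d)) x := by rw [pow_add]; rfl
  rw [a1] at h
  have a2 : T ((T ^ (k + d)) x) = (T ^ (k + d + 1)) x := by rw [pow_succ' T (k + d)]; rfl
  rw [a2] at h
  rw [hmul, mul_assoc]
  exact h.trans (mul_le_mul_of_nonneg_left (le_opNorm _ _) hl.le)
end

section
/- Let T be a bounded linear operator on a complex Hilbert space H that is k-quasi n-power posinormal with constant λ > 0, and let M be a closed subspace of H invariant under T (i.e., T(M) ⊆ M). Then the restriction A = T|_M, viewed as a bounded operator on the Hilbert space M, is k-quasi n-power posinormal; more precisely, A^{*k}(λ² A^*A − A^n A^{*n})A^k ≥ 0 on M. -/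
open ContinuousLinearMap
open scoped ComplexInnerProductSpace ComplexOrder

theorem aux_adj_pow {E : Type*} [NormedAddCommGroup E] [InnerProductSpace ℂ E] [CompleteSpace E]
    (T : E →L[ℂ] E) (k : ℕ) : (adjoint T) ^ k = adjoint (T ^ k) := by
  rw [← star_eq_adjoint, ← star_eq_adjoint, star_pow]

theorem aux_form {E : Type*} [NormedAddCommGroup E] [InnerProductSpace ℂ E] [CompleteSpace E]
    (T : E →L[ℂ] E) (k n : ℕ) (l : ℝ) (x : E) :
    ⟪((adjoint T) ^ k * (((l : ℂ) ^ 2) • (adjoint T * T) - T ^ n * (adjoint T) ^ n) * T ^ k)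
            x, x⟫ =
      ((l ^ 2 * ‖T ((T ^ k) x)‖ ^ 2 - ‖adjoint (T ^ n) ((T ^ k) x)‖ ^ 2 : ℝ) : ℂ) := by
  rw [aux_adj_pow, aux_adj_pow]
  simp only [mul_apply_eq_comp, adjoint_inner_left, ContinuousLinearMap.sub_apply,
    ContinuousLinearMap.smul_apply, inner_sub_left, inner_smul_left]
  rw [← adjoint_inner_right (T ^ n), inner_self_eq_norm_sq_to_K, inner_self_eq_norm_sq_to_K]
  simp

/-- If `T` is `k`-quasi `n`-power posinormal with constant `λ > 0` and `M` is a
closed `T`-invariant subspace of `H`, then the restriction `A = T|_M`, as a bounded operator on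
the Hilbert space `M`, satisfies `A^{*k}(λ² A^*A − Aⁿ A^{*n})A^k ≥ 0`. -/
theorem stmt_4 {H : Type*} [NormedAddCommGroup H] [InnerProductSpace ℂ H] [CompleteSpace H]
    (T : H →L[ℂ] H) (k n : ℕ) (l : ℝ) (hl : 0 < l)
    (hT : ∀ x : H,
      (0 : ℂ) ≤
        ⟪((adjoint T) ^ k * (((l : ℂ) ^ 2) • (adjoint T * T) - T ^ n * (adjoint T) ^ n) * T ^ k)
            x, x⟫)
    (M : Submodule ℂ H) (hMc : IsClosed (M : Set H)) [CompleteSpace M]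
    (hMi : ∀ x ∈ M, T x ∈ M)
    (A : M →L[ℂ] M) (hA : ∀ x : M, (A x : H) = T x) :
    ∀ x : M,
      (0 : ℂ) ≤
        ⟪((adjoint A) ^ k * (((l : ℂ) ^ 2) • (adjoint A * A) - A ^ n * (adjoint A) ^ n) * A ^ k)
            x, x⟫ := by
  intro x
  have hp : ∀ (m : ℕ) (y : M), (((A ^ m) y : M) : H) = (T ^ m) y := by
    intro m
    induction m with
    | zero => intro y; simp
    | succ m ih =>
      intro y
      rw [pow_succ, pow_succ, mul_apply_eq_comp, mul_apply_eq_comp, ih, hA]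
  have h := hT x
  rw [aux_form, Complex.zero_le_real] at h
  rw [aux_form, Complex.zero_le_real]
  have key : ∀ y : M, ‖adjoint (A ^ n) y‖ ≤ ‖adjoint (T ^ n) (y : H)‖ := by
    intro y
    set w := adjoint (A ^ n) y with hw
    have h1 : ⟪w, w⟫ = ⟪(w : H), adjoint (T ^ n) (y : H)⟫ := by
      rw [adjoint_inner_right (T ^ n), ← hp, ← Submodule.coe_inner, ← adjoint_inner_right (A ^ n)]
    have h2 : ‖w‖ * ‖w‖ ≤ ‖w‖ * ‖adjoint (T ^ n) (y : H)‖ := by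
      have := norm_inner_le_norm (𝕜 := ℂ) (w : H) (adjoint (T ^ n) (y : H))
      rw [← h1, inner_self_eq_norm_sq_to_K] at this
      simpa [pow_two] using this
    rcases (norm_nonneg w).eq_or_lt with h0 | h0
    · rw [← h0]; exact norm_nonneg _
    · exact le_of_mul_le_mul_left h2 h0
  have h3 := key ((A ^ k) x)
  have h4 : ‖A ((A ^ k) x)‖ = ‖T ((T ^ k) (x : H))‖ := by
    rw [Submodule.coe_norm, hA, hp]
  rw [hp] at h3
  rw [h4]
  have h5 := pow_le_pow_left₀ (norm_nonneg _) h3 2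
  linarith
end

section
/- Let T be a bounded linear operator on a complex Hilbert space H that is k-quasi n-power posinormal with constant λ > 0, and let S be a unitary operator on H (S^*S = SS^* = I) such that TS = ST. Then TS is k-quasi n-power posinormal with the same constant λ, i.e., (TS)^{*k}(λ²(TS)^*(TS) − (TS)^n(TS)^{*n})(TS)^k ≥ 0. -/
open ContinuousLinearMap
open scoped ComplexInnerProductSpace ComplexOrder

/-- If `T` is `k`-quasi `n`-power posinormal with constant `λ > 0` and `S` is a
unitary operator commuting with `T`, then `TS` is `k`-quasi `n`-power posinormal with the same
constant `λ`. -/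
theorem stmt_5 {H : Type*} [NormedAddCommGroup H] [InnerProductSpace ℂ H] [CompleteSpace H]
    (T S : H →L[ℂ] H) (k n : ℕ) (l : ℝ) (hl : 0 < l)
    (hT : ∀ x : H,
      (0 : ℂ) ≤
        ⟪((adjoint T) ^ k * (((l : ℂ) ^ 2) • (adjoint T * T) - T ^ n * (adjoint T) ^ n) * T ^ k)
            x, x⟫)
    (hS1 : adjoint S * S = 1) (hS2 : S * adjoint S = 1)
    (hTS : T * S = S * T) :
    ∀ x : H,
      (0 : ℂ) ≤
        ⟪((adjoint (T * S)) ^ k *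
            (((l : ℂ) ^ 2) • (adjoint (T * S) * (T * S)) -
              (T * S) ^ n * (adjoint (T * S)) ^ n) * (T * S) ^ k) x, x⟫ := by
  have e : adjoint (T * S) = adjoint S * adjoint T := adjoint_comp T S
  have e' : adjoint (T * S) = adjoint T * adjoint S := by rw [hTS]; exact adjoint_comp S T
  rw [e]
  have cAR : Commute (adjoint T) (adjoint S) := e'.symm.trans e
  have cTS : Commute T S := hTS
  generalize adjoint T = A at *
  generalize adjoint S = R at *
  have cTR : Commute T R := by
    have : R * (T * S) * R = R * (S * T) * R := by rw [hTS]
    calc T * R = (R * S) * T * R := by rw [hS1, one_mul]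
      _ = R * (S * T) * R := by simp only [mul_assoc]
      _ = R * (T * S) * R := this.symm
      _ = R * T * (S * R) := by simp only [mul_assoc]
      _ = R * T := by rw [hS2, mul_one]
  have cAS : Commute A S := by
    have h : S * (A * R) * S = S * (R * A) * S := by rw [cAR.eq]
    calc A * S = (S * R) * A * S := by rw [hS2, one_mul]
      _ = S * (R * A) * S := by simp only [mul_assoc]
      _ = S * (A * R) * S := h.symm
      _ = S * A * (R * S) := by simp only [mul_assoc]
      _ = S * A := by rw [hS1, mul_one]
  have cRS : Commute R S := hS1.trans hS2.symm
  have p1 : ∀ m : ℕ, R ^ m * S ^ m = 1 := fun m => by rw [← cRS.mul_pow, hS1, one_pow]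
  have p2 : ∀ m : ℕ, S ^ m * R ^ m = 1 := fun m => by rw [← cRS.symm.mul_pow, hS2, one_pow]
  have q1 : R * A * (T * S) = A * T := by
    have h : Commute R (A * T) := cAR.symm.mul_right cTR.symm
    calc R * A * (T * S) = R * (A * T) * S := by simp only [mul_assoc]
      _ = A * T * (R * S) := by rw [h.eq, mul_assoc]
      _ = A * T := by rw [hS1, mul_one]
  have q2 : (T * S) ^ n * (R * A) ^ n = T ^ n * A ^ n := by
    rw [cTS.mul_pow, cAR.symm.mul_pow]
    calc T ^ n * S ^ n * (R ^ n * A ^ n) = T ^ n * (S ^ n * R ^ n) * A ^ n := by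
          simp only [mul_assoc]
      _ = _ := by rw [p2, mul_one]
  rw [q1, q2, cTS.mul_pow, cAR.symm.mul_pow]
  have cM : Commute R (((l : ℂ) ^ 2) • (A * T) - T ^ n * A ^ n) :=
    ((cAR.symm.mul_right cTR.symm).smul_right _).sub_right
      ((cTR.symm.pow_right n).mul_right (cAR.symm.pow_right n))
  generalize ((l : ℂ) ^ 2) • (A * T) - T ^ n * A ^ n = M at *
  have cW : Commute (R ^ k) (A ^ k * M * T ^ k) :=
    (((cAR.symm.pow_right k).mul_right cM).mul_right (cTR.symm.pow_right k)).pow_left k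
  have key : R ^ k * A ^ k * M * (T ^ k * S ^ k) = A ^ k * M * T ^ k := by
    calc _ = R ^ k * (A ^ k * M * T ^ k) * S ^ k := by simp only [mul_assoc]
      _ = A ^ k * M * T ^ k * (R ^ k * S ^ k) := by rw [cW.eq, mul_assoc]
      _ = _ := by rw [p1, mul_one]
  rw [key]
  exact hT
end

section
/- Let T be a bounded linear operator on a complex Hilbert space H that is k-quasi n-power posinormal, let U be a unitary operator on H, and set S = U^*TU. Then S is k-quasi n-power posinormal (with the same constant λ). -/
open ContinuousLinearMap
open scoped ComplexInnerProductSpace ComplexOrder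

/-- If `T` is `k`-quasi `n`-power posinormal with constant `λ > 0` and `U` is
unitary, then `S = U^* T U` is `k`-quasi `n`-power posinormal with the same constant `λ`. -/
theorem stmt_6 {H : Type*} [NormedAddCommGroup H] [InnerProductSpace ℂ H] [CompleteSpace H]
    (T U : H →L[ℂ] H) (k n : ℕ) (l : ℝ) (hl : 0 < l)
    (hT : ∀ x : H,
      (0 : ℂ) ≤
        ⟪((adjoint T) ^ k * (((l : ℂ) ^ 2) • (adjoint T * T) - T ^ n * (adjoint T) ^ n) * T ^ k)
            x, x⟫)
    (hU1 : adjoint U * U = 1) (hU2 : U * adjoint U = 1) :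
    ∀ x : H,
      (0 : ℂ) ≤
        ⟪((adjoint (adjoint U * T * U)) ^ k *
            (((l : ℂ) ^ 2) • (adjoint (adjoint U * T * U) * (adjoint U * T * U)) -
              (adjoint U * T * U) ^ n * (adjoint (adjoint U * T * U)) ^ n) *
            (adjoint U * T * U) ^ k) x, x⟫ := by
  intro x
  have hadj : adjoint (adjoint U * T * U) = adjoint U * adjoint T * U := by
    simp only [← star_eq_adjoint, star_mul, star_star, mul_assoc]
  rw [hadj]
  generalize adjoint T = R at *
  have hm : ∀ A B : H →L[ℂ] H,
      (adjoint U * A * U) * (adjoint U * B * U) = adjoint U * (A * B) * U := by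
    intro A B
    calc _ = adjoint U * A * (U * adjoint U) * B * U := by simp only [mul_assoc]
      _ = _ := by rw [hU2]; simp only [mul_assoc, one_mul]
  have hp : ∀ (A : H →L[ℂ] H) (m : ℕ), (adjoint U * A * U) ^ m = adjoint U * A ^ m * U := by
    intro A m
    induction m with
    | zero => simp [hU1]
    | succ m ih => rw [pow_succ, ih, hm, ← pow_succ]
  have hs : ∀ (c : ℂ) (A B : H →L[ℂ] H),
      c • (adjoint U * A * U) - adjoint U * B * U = adjoint U * (c • A - B) * U := by
    intro c A B
    rw [mul_sub, sub_mul, mul_smul_comm, smul_mul_assoc]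
  rw [hp, hp, hp, hp, hm, hm, hs, hm, hm]
  have h := hT (U x)
  rw [← adjoint_inner_left] at h
  exact h
end

section
/- Let T be a bounded linear operator on a complex Hilbert space H, let k, n be natural numbers and λ > 0, and suppose T^{*k}(λ² T^*T − T^n T^{*n})T^k ≥ 0. If T^k has dense range in H, then λ² T^*T − T^n T^{*n} ≥ 0; i.e., T is n-power posinormal. -/
open ContinuousLinearMap
open scoped ComplexInnerProductSpace ComplexOrder

/-- If `T^{*k}(λ² T^*T − Tⁿ T^{*n})T^k ≥ 0` and `T^k` has dense range, then
`λ² T^*T − Tⁿ T^{*n} ≥ 0`, i.e. `T` is `n`-power posinormal. -/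
theorem stmt_7 {H : Type*} [NormedAddCommGroup H] [InnerProductSpace ℂ H] [CompleteSpace H]
    (T : H →L[ℂ] H) (k n : ℕ) (l : ℝ) (hl : 0 < l)
    (hT : ∀ x : H,
      (0 : ℂ) ≤
        ⟪((adjoint T) ^ k * (((l : ℂ) ^ 2) • (adjoint T * T) - T ^ n * (adjoint T) ^ n) * T ^ k)
            x, x⟫)
    (hdense : DenseRange ⇑(T ^ k)) :
    ∀ x : H,
      (0 : ℂ) ≤ ⟪(((l : ℂ) ^ 2) • (adjoint T * T) - T ^ n * (adjoint T) ^ n) x, x⟫ := by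
  generalize ((l : ℂ) ^ 2) • (adjoint T * T) - T ^ n * (adjoint T) ^ n = A at hT ⊢
  intro x
  refine hdense.induction_on (p := fun x => (0 : ℂ) ≤ ⟪A x, x⟫) x ?_ ?_
  · exact isClosed_le continuous_const (by fun_prop)
  · intro y
    have h := hT y
    have e : (adjoint T) ^ k = adjoint (T ^ k) := by
      rw [← star_eq_adjoint, ← star_eq_adjoint, star_pow]
    rw [e, mul_assoc] at h
    change (0 : ℂ) ≤ ⟪adjoint (T ^ k) (A ((T ^ k) y)), y⟫ at h
    rw [adjoint_inner_left] at h
    exact h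
end
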